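/- arXiv:1407.1156 — 4 statements merged into one kernel-verified Lean document; each statement's English description precedes it below -/
import Mathlib

section
/- Let d ≥ 1, s > d/2, n ≥ 1 and M > 0. Then there exists a constant C depending only on d, s, n and M such that for all v, w ∈ h^s with |v|_s ≤ M and |w|_s ≤ M, the sequences R(v, n) = (R_k(v, n))_{k∈ℤ^d} and R(w, n) belong to h^s and |R(v, n) − R(w, n)|_s ≤ C |v − w|_s. -/
open scoped BigOperators

/-- `lam d k = |k|²`, the squared Euclidean norm of `k ∈ ℤ^d`. -/
def lam (d : ℕ) (k : Fin d → ℤ) : ℤ := ∑ i, (k i) ^ 2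

/-- The weight `|k|^{2s} + 1 = (|k|²)^s + 1` in the definition of the `h^s` norm. -/
noncomputable def wt (d : ℕ) (s : ℝ) (k : Fin d → ℤ) : ℝ := ((lam d k : ℝ)) ^ s + 1

/-- `v ∈ h^s`, i.e. the series defining `|v|_s²` converges. -/
def memH (d : ℕ) (s : ℝ) (v : (Fin d → ℤ) → ℂ) : Prop :=
  Summable fun k => wt d s k * ‖v k‖ ^ 2

/-- The norm `|v|_s` of `h^s`. -/
noncomputable def hnorm (d : ℕ) (s : ℝ) (v : (Fin d → ℤ) → ℂ) : ℝ :=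
  Real.sqrt (∑' k, wt d s k * ‖v k‖ ^ 2)

/-- The summand of `P_k(v,n)`: the monomial `v_{k₁} conj(v_{k₂}) ⋯ v_{k_{2n+1}}` if the
tuple `κ` lies in `S(k,n)` (i.e. the alternating sum of `κ` equals `k`), and `0` otherwise. -/
noncomputable def Pterm (d n : ℕ) (v : (Fin d → ℤ) → ℂ) (k : Fin d → ℤ)
    (κ : Fin (2 * n + 1) → (Fin d → ℤ)) : ℂ :=
  if (∑ j : Fin (2 * n + 1), ((-1 : ℤ) ^ (j : ℕ)) • κ j) = k then
    ∏ j : Fin (2 * n + 1), (if Even (j : ℕ) then v (κ j) else (starRingEnd ℂ) (v (κ j)))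
  else 0

/-- `P_k(v,n) = Σ_{(k₁,…,k_{2n+1}) ∈ S(k,n)} v_{k₁} conj(v_{k₂}) ⋯ v_{k_{2n+1}}`. -/
noncomputable def Pk (d n : ℕ) (v : (Fin d → ℤ) → ℂ) (k : Fin d → ℤ) : ℂ :=
  ∑' κ : Fin (2 * n + 1) → (Fin d → ℤ), Pterm d n v k κ

/-- The summand of `R_k(v,n)`: as `Pterm`, but restricted to resonant tuples. -/
noncomputable def Rterm (d n : ℕ) (v : (Fin d → ℤ) → ℂ) (k : Fin d → ℤ)
    (κ : Fin (2 * n + 1) → (Fin d → ℤ)) : ℂ :=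
  if (∑ j : Fin (2 * n + 1), ((-1 : ℤ) ^ (j : ℕ)) • κ j) = k ∧
      (∑ j : Fin (2 * n + 1), ((-1 : ℤ) ^ (j : ℕ)) * lam d (κ j)) = lam d k then
    ∏ j : Fin (2 * n + 1), (if Even (j : ℕ) then v (κ j) else (starRingEnd ℂ) (v (κ j)))
  else 0

/-- `R_k(v,n)`, the resonant part of `P_k(v,n)`. -/
noncomputable def Rk (d n : ℕ) (v : (Fin d → ℤ) → ℂ) (k : Fin d → ℤ) : ℂ :=
  ∑' κ : Fin (2 * n + 1) → (Fin d → ℤ), Rterm d n v k κ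

section Convolution

open scoped ENNReal

theorem ENNReal.sq_tsum_mul_le {ι : Type*} (f g : ι → ℝ≥0∞) :
    (∑' i, f i * g i) ^ 2 ≤ (∑' i, f i ^ 2) * ∑' i, g i ^ 2 := by
  have key : ∑' i, f i * g i ≤
      (∑' i, f i ^ 2) ^ (1 / 2 : ℝ) * (∑' i, g i ^ 2) ^ (1 / 2 : ℝ) := by
    rw [ENNReal.tsum_eq_iSup_sum]
    refine iSup_le fun t => ?_
    have h := ENNReal.inner_le_Lp_mul_Lq t f g (p := 2) (q := 2) Real.HolderConjugate.two_two
    simp only [ENNReal.rpow_ofNat] at h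
    refine h.trans ?_
    gcongr <;> exact ENNReal.sum_le_tsum t
  calc (∑' i, f i * g i) ^ 2
      ≤ ((∑' i, f i ^ 2) ^ (1 / 2 : ℝ) * (∑' i, g i ^ 2) ^ (1 / 2 : ℝ)) ^ 2 := by gcongr
    _ = _ := by
      rw [mul_pow, ← ENNReal.rpow_mul_natCast, ← ENNReal.rpow_mul_natCast]
      norm_num

theorem ENNReal.sq_sum_le_card_mul_sum_sq {ι : Type*} [Fintype ι] (f : ι → ℝ≥0∞) :
    (∑ i, f i) ^ 2 ≤ Fintype.card ι * ∑ i, f i ^ 2 := by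
  simpa [tsum_fintype] using ENNReal.sq_tsum_mul_le (fun _ : ι => (1 : ℝ≥0∞)) f

theorem ENNReal.tsum_fin_succ_pi {G : Type*} (m : ℕ) (F : (Fin (m + 1) → G) → ℝ≥0∞) :
    ∑' κ, F κ = ∑' l, ∑' κ : Fin m → G, F (Fin.cons l κ) := by
  rw [← (Fin.consEquiv (fun _ : Fin (m + 1) => G)).tsum_eq, ENNReal.tsum_prod']
  rfl

theorem ENNReal.tsum_pi_prod {G : Type*} (m : ℕ) (h : G → ℝ≥0∞) :
    ∑' κ : Fin m → G, ∏ i, h (κ i) = (∑' x, h x) ^ m := by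
  induction m with
  | zero => simp
  | succ m ih =>
    rw [ENNReal.tsum_fin_succ_pi]
    simp only [Fin.prod_univ_succ, Fin.cons_zero, Fin.cons_succ, ENNReal.tsum_mul_left, ih,
      ENNReal.tsum_mul_right]
    rw [pow_succ']

theorem lam_nonneg (d : ℕ) (k : Fin d → ℤ) : 0 ≤ lam d k :=
  Finset.sum_nonneg fun _ _ => sq_nonneg _

theorem lam_add_le (d : ℕ) (a b : Fin d → ℤ) : lam d (a + b) ≤ 2 * lam d a + 2 * lam d b := by
  unfold lam
  rw [Finset.mul_sum, Finset.mul_sum, ← Finset.sum_add_distrib]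
  refine Finset.sum_le_sum fun i _ => ?_
  simp only [Pi.add_apply]
  nlinarith [sq_nonneg (a i - b i)]

theorem one_le_wt (d : ℕ) (s : ℝ) (k : Fin d → ℤ) : 1 ≤ wt d s k := by
  have h : (0 : ℝ) ≤ lam d k := by exact_mod_cast lam_nonneg d k
  have := Real.rpow_nonneg h s
  unfold wt
  linarith

theorem wt_smul {d : ℕ} {s : ℝ} {ε : ℤ} (hε : ε = 1 ∨ ε = -1) (k : Fin d → ℤ) :
    wt d s (ε • k) = wt d s k := by
  rcases hε with rfl | rfl <;> simp [wt, lam]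

theorem wt_add_le {d : ℕ} {s : ℝ} (hs : 0 ≤ s) (a b : Fin d → ℤ) :
    wt d s (a + b) ≤ 4 ^ s * (wt d s a + wt d s b) := by
  have ha : (0 : ℝ) ≤ lam d a := by exact_mod_cast lam_nonneg d a
  have hb : (0 : ℝ) ≤ lam d b := by exact_mod_cast lam_nonneg d b
  have hab : (0 : ℝ) ≤ lam d (a + b) := by exact_mod_cast lam_nonneg d (a + b)
  have h : (lam d (a + b) : ℝ) ≤ 2 * lam d a + 2 * lam d b := by exact_mod_cast lam_add_le d a b
  have h4 : (1 : ℝ) ≤ 4 ^ s := Real.one_le_rpow (by norm_num) hs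
  have ha' := Real.rpow_nonneg ha s
  have hb' := Real.rpow_nonneg hb s
  have hmain : (lam d (a + b) : ℝ) ^ s ≤ 4 ^ s * ((lam d a : ℝ) ^ s + (lam d b : ℝ) ^ s) := by
    rcases le_total (lam d a : ℝ) (lam d b) with hle | hle
    · calc (lam d (a + b) : ℝ) ^ s ≤ (4 * lam d b) ^ s :=
            Real.rpow_le_rpow hab (by linarith) hs
        _ = 4 ^ s * (lam d b : ℝ) ^ s := Real.mul_rpow (by norm_num) hb
        _ ≤ _ := by gcongr; linarith
    · calc (lam d (a + b) : ℝ) ^ s ≤ (4 * lam d a) ^ s :=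
            Real.rpow_le_rpow hab (by linarith) hs
        _ = 4 ^ s * (lam d a : ℝ) ^ s := Real.mul_rpow (by norm_num) ha
        _ ≤ _ := by gcongr; linarith
  unfold wt
  nlinarith

/-- The weight `wt` with values in `[0, ∞]`. -/
noncomputable def ewt (d : ℕ) (s : ℝ) (k : Fin d → ℤ) : ℝ≥0∞ := ENNReal.ofReal (wt d s k)

theorem one_le_ewt (d : ℕ) (s : ℝ) (k : Fin d → ℤ) : 1 ≤ ewt d s k := by
  simpa [ewt] using one_le_wt d s k

theorem ewt_ne_zero (d : ℕ) (s : ℝ) (k : Fin d → ℤ) : ewt d s k ≠ 0 :=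
  (zero_lt_one.trans_le (one_le_ewt d s k)).ne'

theorem ewt_ne_top (d : ℕ) (s : ℝ) (k : Fin d → ℤ) : ewt d s k ≠ ∞ := ENNReal.ofReal_ne_top

theorem prod_max_one_rpow_le_wt {d : ℕ} (hd : 1 ≤ d) {s : ℝ} (hs : 0 ≤ s) (k : Fin d → ℤ) :
    ∏ i, (max 1 |(k i : ℝ)|) ^ (2 * s / d) ≤ wt d s k := by
  have hd' : (d : ℝ) ≠ 0 := by positivity
  have h0 : 0 ≤ wt d s k := zero_le_one.trans (one_le_wt d s k)
  have hlam : (0 : ℝ) ≤ lam d k := by exact_mod_cast lam_nonneg d k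
  have key : ∀ i, (max 1 |(k i : ℝ)|) ^ (2 * s) ≤ wt d s k := by
    intro i
    rcases le_total |(k i : ℝ)| 1 with h | h
    · rw [max_eq_left h, Real.one_rpow]
      exact one_le_wt d s k
    · rw [max_eq_right h, Real.rpow_mul (abs_nonneg _)]
      have hle : (k i : ℝ) ^ 2 ≤ lam d k := by
        have : (k i) ^ 2 ≤ lam d k :=
          Finset.single_le_sum (f := fun i => (k i) ^ 2) (fun _ _ => sq_nonneg _)
            (Finset.mem_univ i)
        exact_mod_cast this
      have := Real.rpow_le_rpow (sq_nonneg _) hle hs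
      simp only [Real.rpow_ofNat, sq_abs]
      unfold wt
      linarith
  calc ∏ i, (max 1 |(k i : ℝ)|) ^ (2 * s / d)
      ≤ ∏ _i : Fin d, wt d s k ^ (1 / d : ℝ) := by
        refine Finset.prod_le_prod (fun _ _ => by positivity) fun i _ => ?_
        rw [div_eq_mul_one_div, Real.rpow_mul (by positivity)]
        exact Real.rpow_le_rpow (by positivity) (key i) (by positivity)
    _ = wt d s k := by
        rw [Finset.prod_const, Finset.card_univ, Fintype.card_fin, ← Real.rpow_mul_natCast h0,
          one_div_mul_cancel hd', Real.rpow_one]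

theorem summable_max_one_abs_rpow {t : ℝ} (ht : 1 < t) :
    Summable fun m : ℤ => (max 1 |(m : ℝ)|) ^ (-t) := by
  refine (Real.summable_abs_int_rpow ht).congr_cofinite ?_
  filter_upwards [(Set.finite_singleton (0 : ℤ)).compl_mem_cofinite] with m hm
  have h1 : (1 : ℝ) ≤ |(m : ℝ)| := by exact_mod_cast Int.one_le_abs hm
  rw [max_eq_right h1]

theorem tsum_inv_ewt_ne_top {d : ℕ} (hd : 1 ≤ d) {s : ℝ} (hs : (d : ℝ) / 2 < s) :
    ∑' k, (ewt d s k)⁻¹ ≠ ∞ := by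
  have hd' : (0 : ℝ) < d := by positivity
  have hs0 : 0 ≤ s := by linarith
  have ht : 1 < 2 * s / d := by rw [lt_div_iff₀ hd']; linarith
  have hle : ∀ k : Fin d → ℤ, (ewt d s k)⁻¹ ≤
      ∏ i, ENNReal.ofReal ((max 1 |(k i : ℝ)|) ^ (-(2 * s / d))) := by
    intro k
    rw [← ENNReal.ofReal_prod_of_nonneg (fun _ _ => by positivity), ewt,
      ← ENNReal.ofReal_inv_of_pos (zero_lt_one.trans_le (one_le_wt d s k))]
    refine ENNReal.ofReal_le_ofReal ?_
    have hrw : ∏ i, (max 1 |(k i : ℝ)|) ^ (-(2 * s / d)) =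
        (∏ i, (max 1 |(k i : ℝ)|) ^ (2 * s / d))⁻¹ := by
      rw [← Finset.prod_inv_distrib]
      exact Finset.prod_congr rfl fun i _ => Real.rpow_neg (by positivity) _
    rw [hrw]
    exact inv_anti₀ (Finset.prod_pos fun _ _ => by positivity) (prod_max_one_rpow_le_wt hd hs0 k)
  refine ne_top_of_le_ne_top ?_ (ENNReal.tsum_le_tsum hle)
  rw [ENNReal.tsum_pi_prod d fun m : ℤ => ENNReal.ofReal ((max 1 |(m : ℝ)|) ^ (-(2 * s / d)))]
  exact ENNReal.pow_ne_top (summable_max_one_abs_rpow ht).tsum_ofReal_ne_top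

/-- The square of the `h^s` norm of a sequence with values in `[0, ∞]`. -/
noncomputable def enormSq (d : ℕ) (s : ℝ) (f : (Fin d → ℤ) → ℝ≥0∞) : ℝ≥0∞ :=
  ∑' k, ewt d s k * f k ^ 2

theorem enormSq_mono {d : ℕ} {s : ℝ} {f g : (Fin d → ℤ) → ℝ≥0∞} (h : ∀ k, f k ≤ g k) :
    enormSq d s f ≤ enormSq d s g :=
  ENNReal.tsum_le_tsum fun k => by gcongr; exact h k

theorem ne_top_of_enormSq_ne_top {d : ℕ} {s : ℝ} {f : (Fin d → ℤ) → ℝ≥0∞}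
    (h : enormSq d s f ≠ ∞) (k : Fin d → ℤ) : f k ≠ ∞ := by
  intro hk
  refine ENNReal.ne_top_of_tsum_ne_top h k ?_
  simp [hk, ENNReal.mul_top, ewt_ne_zero]

theorem enormSq_sum_le {d : ℕ} {s : ℝ} {ι : Type*} [Fintype ι] (f : ι → (Fin d → ℤ) → ℝ≥0∞) :
    enormSq d s (fun k => ∑ i, f i k) ≤ Fintype.card ι * ∑ i, enormSq d s (f i) := by
  unfold enormSq
  rw [← Summable.tsum_finsetSum fun _ _ => ENNReal.summable, ← ENNReal.tsum_mul_left]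
  refine ENNReal.tsum_le_tsum fun k => ?_
  calc ewt d s k * (∑ i, f i k) ^ 2 ≤ ewt d s k * (Fintype.card ι * ∑ i, f i k ^ 2) := by
        gcongr
        exact ENNReal.sq_sum_le_card_mul_sum_sq _
    _ = _ := by rw [← Finset.mul_sum]; ring

theorem enormSq_add_le {d : ℕ} {s : ℝ} (f g : (Fin d → ℤ) → ℝ≥0∞) :
    enormSq d s (fun k => f k + g k) ≤ 2 * (enormSq d s f + enormSq d s g) := by
  simpa using enormSq_sum_le (d := d) (s := s) ![f, g]

/-- The constant in the algebra property of `h^s`. -/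
noncomputable def algConst (d : ℕ) (s : ℝ) : ℝ≥0∞ :=
  ENNReal.ofReal (4 ^ s) * (2 * ∑' k, (ewt d s k)⁻¹)

theorem algConst_ne_top {d : ℕ} (hd : 1 ≤ d) {s : ℝ} (hs : (d : ℝ) / 2 < s) :
    algConst d s ≠ ∞ :=
  ENNReal.mul_ne_top ENNReal.ofReal_ne_top
    (ENNReal.mul_ne_top (by simp) (tsum_inv_ewt_ne_top hd hs))

theorem ewt_le {d : ℕ} {s : ℝ} (hs : 0 ≤ s) {ε : ℤ} (hε : ε = 1 ∨ ε = -1) (k l : Fin d → ℤ) :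
    ewt d s k ≤ ENNReal.ofReal (4 ^ s) * (ewt d s l + ewt d s (k - ε • l)) := by
  have hl := zero_le_one.trans (one_le_wt d s l)
  have hr := zero_le_one.trans (one_le_wt d s (k - ε • l))
  unfold ewt
  rw [← ENNReal.ofReal_add hl hr, ← ENNReal.ofReal_mul (by positivity)]
  refine ENNReal.ofReal_le_ofReal ?_
  have h := wt_add_le hs (ε • l) (k - ε • l)
  rwa [add_sub_cancel, wt_smul hε] at h

theorem ewt_mul_tsum_inv_le {d : ℕ} {s : ℝ} (hs : 0 ≤ s) {ε : ℤ} (hε : ε = 1 ∨ ε = -1)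
    (k : Fin d → ℤ) :
    ewt d s k * ∑' l, (ewt d s l)⁻¹ * (ewt d s (k - ε • l))⁻¹ ≤ algConst d s := by
  have hinj : Function.Injective fun l : Fin d → ℤ => k - ε • l := by
    intro a b hab
    rcases hε with rfl | rfl <;> simpa using hab
  rw [← ENNReal.tsum_mul_left]
  calc ∑' l, ewt d s k * ((ewt d s l)⁻¹ * (ewt d s (k - ε • l))⁻¹)
      ≤ ∑' l, ENNReal.ofReal (4 ^ s) * ((ewt d s (k - ε • l))⁻¹ + (ewt d s l)⁻¹) := by
        refine ENNReal.tsum_le_tsum fun l => ?_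
        calc _ ≤ ENNReal.ofReal (4 ^ s) * (ewt d s l + ewt d s (k - ε • l)) *
              ((ewt d s l)⁻¹ * (ewt d s (k - ε • l))⁻¹) := by
              gcongr
              exact ewt_le hs hε k l
          _ = ENNReal.ofReal (4 ^ s) *
              ((ewt d s l * (ewt d s l)⁻¹) * (ewt d s (k - ε • l))⁻¹ +
                (ewt d s (k - ε • l) * (ewt d s (k - ε • l))⁻¹) * (ewt d s l)⁻¹) := by ring
          _ = _ := by
              rw [ENNReal.mul_inv_cancel (ewt_ne_zero _ _ _) (ewt_ne_top _ _ _),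
                ENNReal.mul_inv_cancel (ewt_ne_zero _ _ _) (ewt_ne_top _ _ _), one_mul, one_mul]
    _ ≤ algConst d s := by
        rw [ENNReal.tsum_mul_left, ENNReal.tsum_add, algConst, two_mul]
        have h := ENNReal.tsum_comp_le_tsum_of_injective hinj fun l => (ewt d s l)⁻¹
        exact mul_le_mul_right (add_le_add_left h _) _

/-- The algebra property of `h^s`. -/
theorem enormSq_conv_le {d : ℕ} {s : ℝ} (hs : 0 ≤ s) {ε : ℤ} (hε : ε = 1 ∨ ε = -1)
    (f g : (Fin d → ℤ) → ℝ≥0∞) :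
    enormSq d s (fun k => ∑' l, f l * g (k - ε • l)) ≤
      algConst d s * (enormSq d s f * enormSq d s g) := by
  have hpt : ∀ k, ewt d s k * (∑' l, f l * g (k - ε • l)) ^ 2 ≤ algConst d s *
      ∑' l, (ewt d s l * f l ^ 2) * (ewt d s (k - ε • l) * g (k - ε • l) ^ 2) := by
    intro k
    set a : (Fin d → ℤ) → ℝ≥0∞ := fun l => ewt d s l * ewt d s (k - ε • l) with ha
    have ha0 : ∀ l, a l ≠ 0 := fun l => mul_ne_zero (ewt_ne_zero _ _ _) (ewt_ne_zero _ _ _)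
    have hat : ∀ l, a l ≠ ∞ := fun l => ENNReal.mul_ne_top (ewt_ne_top _ _ _) (ewt_ne_top _ _ _)
    have hsq : ∀ x : ℝ≥0∞, (x ^ (1 / 2 : ℝ)) ^ 2 = x := fun x => by
      rw [← ENNReal.rpow_mul_natCast]; norm_num
    have hcs := ENNReal.sq_tsum_mul_le (fun l => ((a l)⁻¹) ^ (1 / 2 : ℝ))
      (fun l => (a l) ^ (1 / 2 : ℝ) * (f l * g (k - ε • l)))
    have h1 : ∀ l, ((a l)⁻¹) ^ (1 / 2 : ℝ) * ((a l) ^ (1 / 2 : ℝ) * (f l * g (k - ε • l))) =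
        f l * g (k - ε • l) := fun l => by
      rw [← mul_assoc, ← ENNReal.mul_rpow_of_nonneg _ _ (by norm_num),
        ENNReal.inv_mul_cancel (ha0 l) (hat l), ENNReal.one_rpow, one_mul]
    simp only [h1, hsq, mul_pow (_ ^ (1 / 2 : ℝ))] at hcs
    have hinv : ∀ l, (a l)⁻¹ = (ewt d s l)⁻¹ * (ewt d s (k - ε • l))⁻¹ := fun l =>
      ENNReal.mul_inv (.inl (ewt_ne_zero _ _ _)) (.inl (ewt_ne_top _ _ _))
    calc _ ≤ ewt d s k * ((∑' l, (a l)⁻¹) * ∑' l, a l * (f l * g (k - ε • l)) ^ 2) := by gcongr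
      _ = (ewt d s k * ∑' l, (ewt d s l)⁻¹ * (ewt d s (k - ε • l))⁻¹) *
            ∑' l, a l * (f l * g (k - ε • l)) ^ 2 := by simp only [hinv, mul_assoc]
      _ ≤ algConst d s * ∑' l, a l * (f l * g (k - ε • l)) ^ 2 := by
          gcongr
          exact ewt_mul_tsum_inv_le hs hε k
      _ = _ := by
          congr 1
          refine tsum_congr fun l => ?_
          simp only [ha]
          ring
  calc _ ≤ ∑' k, algConst d s *
        ∑' l, (ewt d s l * f l ^ 2) * (ewt d s (k - ε • l) * g (k - ε • l) ^ 2) :=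
        ENNReal.tsum_le_tsum hpt
    _ = algConst d s * (enormSq d s f * enormSq d s g) := by
        rw [ENNReal.tsum_mul_left, ENNReal.tsum_comm]
        congr 1
        unfold enormSq
        rw [← ENNReal.tsum_mul_right]
        refine tsum_congr fun l => ?_
        rw [ENNReal.tsum_mul_left]
        congr 1
        exact (Equiv.subRight (ε • l)).tsum_eq fun k => ewt d s k * g k ^ 2

/-- The convolution of `m` sequences, with the signs `e` on the frequencies. -/
noncomputable def multiConv {d : ℕ} (m : ℕ) (e : Fin m → ℤ) (f : Fin m → (Fin d → ℤ) → ℝ≥0∞)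
    (k : Fin d → ℤ) : ℝ≥0∞ :=
  ∑' κ : Fin m → (Fin d → ℤ), if ∑ j, e j • κ j = k then ∏ j, f j (κ j) else 0

theorem multiConv_succ {d : ℕ} (m : ℕ) (e : Fin (m + 1) → ℤ)
    (f : Fin (m + 1) → (Fin d → ℤ) → ℝ≥0∞) (k : Fin d → ℤ) :
    multiConv (m + 1) e f k =
      ∑' l, f 0 l * multiConv m (fun j => e j.succ) (fun j => f j.succ) (k - e 0 • l) := by
  unfold multiConv
  rw [ENNReal.tsum_fin_succ_pi]
  refine tsum_congr fun l => ?_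
  rw [← ENNReal.tsum_mul_left]
  refine tsum_congr fun κ => ?_
  simp only [Fin.sum_univ_succ, Fin.prod_univ_succ, Fin.cons_zero, Fin.cons_succ, mul_ite,
    mul_zero, eq_sub_iff_add_eq']

theorem enormSq_multiConv_le {d : ℕ} {s : ℝ} (hs : 0 < s) (m : ℕ) (e : Fin m → ℤ)
    (he : ∀ j, e j = 1 ∨ e j = -1) (f : Fin m → (Fin d → ℤ) → ℝ≥0∞) :
    enormSq d s (multiConv m e f) ≤ algConst d s ^ m * ∏ j, enormSq d s (f j) := by
  induction m with
  | zero =>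
    have h0 : ewt d s 0 = 1 := by simp [ewt, wt, lam, Real.zero_rpow hs.ne']
    unfold enormSq
    rw [tsum_eq_single 0]
    · simp [multiConv, h0]
    · intro k hk
      simp [multiConv, hk.symm]
  | succ m ih =>
    have hfun : multiConv (m + 1) e f = fun k =>
        ∑' l, f 0 l * multiConv m (fun j => e j.succ) (fun j => f j.succ) (k - e 0 • l) :=
      funext fun k => multiConv_succ m e f k
    rw [hfun]
    refine (enormSq_conv_le hs.le (he 0) _ _).trans ?_
    calc _ ≤ algConst d s * (enormSq d s (f 0) *
          (algConst d s ^ m * ∏ j : Fin m, enormSq d s (f j.succ))) := by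
          gcongr
          exact ih _ (fun j => he j.succ) _
      _ = _ := by rw [Fin.prod_univ_succ]; ring

end Convolution

section Resonant

open scoped ENNReal

theorem enormSq_enorm_eq {d : ℕ} {s : ℝ} (v : (Fin d → ℤ) → ℂ) :
    enormSq d s (fun k => ‖v k‖ₑ) = ∑' k, ENNReal.ofReal (wt d s k * ‖v k‖ ^ 2) := by
  refine tsum_congr fun k => ?_
  rw [ENNReal.ofReal_mul (zero_le_one.trans (one_le_wt d s k)),
    ENNReal.ofReal_pow (norm_nonneg _), ofReal_norm, ewt]

theorem wt_mul_sq_nonneg {d : ℕ} {s : ℝ} (v : (Fin d → ℤ) → ℂ) (k : Fin d → ℤ) :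
    0 ≤ wt d s k * ‖v k‖ ^ 2 :=
  mul_nonneg (zero_le_one.trans (one_le_wt d s k)) (sq_nonneg _)

theorem memH_iff_enormSq_ne_top {d : ℕ} {s : ℝ} (v : (Fin d → ℤ) → ℂ) :
    memH d s v ↔ enormSq d s (fun k => ‖v k‖ₑ) ≠ ∞ := by
  rw [enormSq_enorm_eq]
  refine ⟨fun h => h.tsum_ofReal_ne_top, fun h => ?_⟩
  refine (ENNReal.summable_toReal h).congr fun k => ?_
  exact ENNReal.toReal_ofReal (wt_mul_sq_nonneg v k)

theorem hnorm_eq_sqrt_enormSq {d : ℕ} {s : ℝ} (v : (Fin d → ℤ) → ℂ) :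
    hnorm d s v = √(enormSq d s fun k => ‖v k‖ₑ).toReal := by
  rw [enormSq_enorm_eq, ENNReal.tsum_toReal_eq fun _ => ENNReal.ofReal_ne_top, hnorm]
  congr 1
  exact tsum_congr fun k => (ENNReal.toReal_ofReal (wt_mul_sq_nonneg v k)).symm

theorem enormSq_le_of_hnorm_le {d : ℕ} {s M : ℝ} {v : (Fin d → ℤ) → ℂ} (hv : memH d s v)
    (h : hnorm d s v ≤ M) : enormSq d s (fun k => ‖v k‖ₑ) ≤ ENNReal.ofReal (M ^ 2) := by
  rw [hnorm_eq_sqrt_enormSq] at h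
  exact (ENNReal.le_ofReal_iff_toReal_le ((memH_iff_enormSq_ne_top v).1 hv) (sq_nonneg M)).2
    (Real.sqrt_le_iff.1 h).2

theorem enorm_finset_prod {ι : Type*} (t : Finset ι) (a : ι → ℂ) :
    ‖∏ j ∈ t, a j‖ₑ = ∏ j ∈ t, ‖a j‖ₑ := by
  simp only [enorm_eq_nnnorm, nnnorm_prod, ENNReal.ofNNReal_finsetProd]

theorem enorm_prod_sub_prod_le {ι : Type*} [DecidableEq ι] (t : Finset ι) (a b : ι → ℂ) :
    ‖∏ j ∈ t, a j - ∏ j ∈ t, b j‖ₑ ≤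
      ∑ i ∈ t, ∏ j ∈ t, if j = i then ‖a j - b j‖ₑ else ‖a j‖ₑ + ‖b j‖ₑ := by
  induction t using Finset.induction_on with
  | empty => simp
  | insert x t hx ih =>
    rw [Finset.prod_insert hx, Finset.prod_insert hx, Finset.sum_insert hx]
    have hsplit : a x * ∏ j ∈ t, a j - b x * ∏ j ∈ t, b j =
        (a x - b x) * ∏ j ∈ t, a j + b x * (∏ j ∈ t, a j - ∏ j ∈ t, b j) := by ring
    rw [hsplit]
    refine (enorm_add_le _ _).trans ?_
    rw [enorm_mul, enorm_mul]
    gcongr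
    · rw [Finset.prod_insert hx, if_pos rfl]
      gcongr
      rw [enorm_finset_prod]
      refine Finset.prod_le_prod' fun j hj => ?_
      rw [if_neg (ne_of_mem_of_not_mem hj hx)]
      exact le_self_add
    · calc _ ≤ ‖b x‖ₑ * ∑ i ∈ t, ∏ j ∈ t, if j = i then ‖a j - b j‖ₑ else ‖a j‖ₑ + ‖b j‖ₑ := by
            gcongr
        _ ≤ _ := by
            rw [Finset.mul_sum]
            refine Finset.sum_le_sum fun i hi => ?_
            rw [Finset.prod_insert hx, if_neg (ne_of_mem_of_not_mem hi hx).symm]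
            gcongr
            exact le_add_self

/-- The signs `1, -1, 1, …` of the alternating sum. -/
def altSign (m : ℕ) (j : Fin m) : ℤ := (-1) ^ (j : ℕ)

theorem altSign_eq (m : ℕ) (j : Fin m) : altSign m j = 1 ∨ altSign m j = -1 :=
  neg_one_pow_eq_or ℤ _

theorem enorm_Rterm_le {d n : ℕ} (v : (Fin d → ℤ) → ℂ) (k : Fin d → ℤ)
    (κ : Fin (2 * n + 1) → (Fin d → ℤ)) :
    ‖Rterm d n v k κ‖ₑ ≤
      if ∑ j, altSign (2 * n + 1) j • κ j = k then ∏ j, ‖v (κ j)‖ₑ else 0 := by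
  unfold Rterm altSign
  split_ifs with h1 h2 h2
  · refine (enorm_finset_prod _ _).le.trans (Finset.prod_le_prod' fun j _ => ?_)
    split_ifs <;> simp
  · exact absurd h1.1 h2
  · simp
  · simp

theorem enorm_Rterm_sub_le {d n : ℕ} (v w : (Fin d → ℤ) → ℂ) (k : Fin d → ℤ)
    (κ : Fin (2 * n + 1) → (Fin d → ℤ)) :
    ‖Rterm d n v k κ - Rterm d n w k κ‖ₑ ≤
      ∑ i, if ∑ j, altSign (2 * n + 1) j • κ j = k then
        ∏ j, (if j = i then fun l => ‖v l - w l‖ₑ else fun l => ‖v l‖ₑ + ‖w l‖ₑ) (κ j) else 0 := by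
  unfold Rterm altSign
  split_ifs with h1 h2 h2
  · refine (enorm_prod_sub_prod_le _ _ _).trans ?_
    refine Finset.sum_le_sum fun i _ => Finset.prod_le_prod' fun j _ => ?_
    split_ifs <;> simp [← map_sub]
  · exact absurd h1.1 h2
  · simp
  · simp

theorem enormSq_multiConv_const_ne_top {d m : ℕ} (hd : 1 ≤ d) {s : ℝ} (hs : (d : ℝ) / 2 < s)
    {v : (Fin d → ℤ) → ℂ} (hv : memH d s v) :
    enormSq d s (multiConv m (altSign m) fun _ k => ‖v k‖ₑ) ≠ ∞ := by
  have hs0 : 0 < s := lt_of_le_of_lt (by positivity) hs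
  refine ne_top_of_le_ne_top ?_ (enormSq_multiConv_le hs0 m _ (altSign_eq m) _)
  exact ENNReal.mul_ne_top (ENNReal.pow_ne_top (algConst_ne_top hd hs))
    (ENNReal.prod_ne_top fun _ _ => (memH_iff_enormSq_ne_top v).1 hv)

theorem tsum_enorm_Rterm_le {d n : ℕ} (v : (Fin d → ℤ) → ℂ) (k : Fin d → ℤ) :
    ∑' κ, ‖Rterm d n v k κ‖ₑ ≤
      multiConv (2 * n + 1) (altSign (2 * n + 1)) (fun _ k => ‖v k‖ₑ) k :=
  ENNReal.tsum_le_tsum fun κ => enorm_Rterm_le v k κ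

theorem summable_Rterm {d n : ℕ} (hd : 1 ≤ d) {s : ℝ} (hs : (d : ℝ) / 2 < s)
    {v : (Fin d → ℤ) → ℂ} (hv : memH d s v) (k : Fin d → ℤ) : Summable (Rterm d n v k) := by
  refine Summable.of_enorm (ne_top_of_le_ne_top ?_ (tsum_enorm_Rterm_le v k))
  exact ne_top_of_enormSq_ne_top (enormSq_multiConv_const_ne_top hd hs hv) k

theorem memH_Rk {d n : ℕ} (hd : 1 ≤ d) {s : ℝ} (hs : (d : ℝ) / 2 < s)
    {v : (Fin d → ℤ) → ℂ} (hv : memH d s v) : memH d s (fun k => Rk d n v k) := by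
  rw [memH_iff_enormSq_ne_top]
  refine ne_top_of_le_ne_top (enormSq_multiConv_const_ne_top (m := 2 * n + 1) hd hs hv)
    (enormSq_mono fun k => ?_)
  exact enorm_tsum_le_tsum_enorm.trans (tsum_enorm_Rterm_le v k)

theorem enormSq_Rk_sub_le {d n : ℕ} (hd : 1 ≤ d) {s : ℝ} (hs : (d : ℝ) / 2 < s)
    {v w : (Fin d → ℤ) → ℂ} (hv : memH d s v) (hw : memH d s w) :
    enormSq d s (fun k => ‖Rk d n v k - Rk d n w k‖ₑ) ≤
      (2 * n + 1 : ℕ) * ((2 * n + 1 : ℕ) * (algConst d s ^ (2 * n + 1) *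
        (enormSq d s (fun k => ‖v k - w k‖ₑ) *
          enormSq d s (fun k => ‖v k‖ₑ + ‖w k‖ₑ) ^ (2 * n)))) := by
  have hs0 : 0 < s := lt_of_le_of_lt (by positivity) hs
  set F : Fin (2 * n + 1) → Fin (2 * n + 1) → (Fin d → ℤ) → ℝ≥0∞ := fun i j =>
    if j = i then fun l => ‖v l - w l‖ₑ else fun l => ‖v l‖ₑ + ‖w l‖ₑ with hF
  have hpt : ∀ k, ‖Rk d n v k - Rk d n w k‖ₑ ≤
      ∑ i, multiConv (2 * n + 1) (altSign (2 * n + 1)) (F i) k := by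
    intro k
    unfold Rk multiConv
    rw [← (summable_Rterm hd hs hv k).tsum_sub (summable_Rterm hd hs hw k),
      ← Summable.tsum_finsetSum fun _ _ => ENNReal.summable]
    exact enorm_tsum_le_tsum_enorm.trans
      (ENNReal.tsum_le_tsum fun κ => enorm_Rterm_sub_le v w k κ)
  have hprod : ∀ i, ∏ j, enormSq d s (F i j) = enormSq d s (fun k => ‖v k - w k‖ₑ) *
      enormSq d s (fun k => ‖v k‖ₑ + ‖w k‖ₑ) ^ (2 * n) := by
    intro i
    rw [Fintype.prod_eq_mul_prod_compl i, hF]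
    congr 1
    · simp
    · rw [Finset.prod_congr rfl (g := fun _ => enormSq d s (fun k => ‖v k‖ₑ + ‖w k‖ₑ))]
      · simp [Finset.card_compl]
      · intro j hj
        have hji : j ≠ i := by simpa using hj
        simp only [if_neg hji]
  refine (enormSq_mono hpt).trans ((enormSq_sum_le _).trans ?_)
  rw [Fintype.card_fin]
  gcongr
  refine (Finset.sum_le_sum fun i _ =>
    (enormSq_multiConv_le hs0 _ _ (altSign_eq _) (F i)).trans_eq (by rw [hprod i])).trans ?_
  simp

end Resonant

/-- For `d ≥ 1`, `s > d/2`, `n ≥ 1` and `M > 0` there is `C = C(d,s,n,M)`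
such that for all `v, w ∈ h^s` with `|v|_s ≤ M`, `|w|_s ≤ M`, the sequences
`R(v,n)` and `R(w,n)` belong to `h^s` and `|R(v,n) − R(w,n)|_s ≤ C |v − w|_s`. -/
theorem R_locally_lipschitz (d n : ℕ) (hd : 1 ≤ d) (hn : 1 ≤ n) (s : ℝ)
    (hs : (d : ℝ) / 2 < s) (M : ℝ) (hM : 0 < M) :
    ∃ C : ℝ, 0 < C ∧ ∀ v w : (Fin d → ℤ) → ℂ, memH d s v → memH d s w →
      hnorm d s v ≤ M → hnorm d s w ≤ M →
      memH d s (fun k => Rk d n v k) ∧ memH d s (fun k => Rk d n w k) ∧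
      hnorm d s (fun k => Rk d n v k - Rk d n w k)
        ≤ C * hnorm d s (fun k => v k - w k) := by
  set B : ENNReal := (2 * n + 1 : ℕ) * ((2 * n + 1 : ℕ) * (algConst d s ^ (2 * n + 1) *
    (2 * (ENNReal.ofReal (M ^ 2) + ENNReal.ofReal (M ^ 2))) ^ (2 * n))) with hB
  have hBtop : B ≠ ⊤ := by
    have := algConst_ne_top hd hs
    finiteness
  refine ⟨√B.toReal + 1, by positivity, fun v w hv hw hvM hwM =>
    ⟨memH_Rk hd hs hv, memH_Rk hd hs hw, ?_⟩⟩
  have hsum : enormSq d s (fun k => ‖v k‖ₑ + ‖w k‖ₑ) ≤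
      2 * (ENNReal.ofReal (M ^ 2) + ENNReal.ofReal (M ^ 2)) :=
    (enormSq_add_le _ _).trans (by
      gcongr
      · exact enormSq_le_of_hnorm_le hv hvM
      · exact enormSq_le_of_hnorm_le hw hwM)
  have hdiff : enormSq d s (fun k => ‖v k - w k‖ₑ) ≠ ⊤ := by
    refine ne_top_of_le_ne_top ?_
      (enormSq_mono (g := fun k => ‖v k‖ₑ + ‖w k‖ₑ) fun k => enorm_sub_le)
    exact ne_top_of_le_ne_top (by finiteness) hsum
  have hle : enormSq d s (fun k => ‖Rk d n v k - Rk d n w k‖ₑ) ≤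
      B * enormSq d s (fun k => ‖v k - w k‖ₑ) := by
    refine (enormSq_Rk_sub_le hd hs hv hw).trans ?_
    calc _ ≤ (2 * n + 1 : ℕ) * ((2 * n + 1 : ℕ) * (algConst d s ^ (2 * n + 1) *
          (enormSq d s (fun k => ‖v k - w k‖ₑ) *
            (2 * (ENNReal.ofReal (M ^ 2) + ENNReal.ofReal (M ^ 2))) ^ (2 * n)))) := by gcongr
      _ = _ := by rw [hB]; ring
  rw [hnorm_eq_sqrt_enormSq, hnorm_eq_sqrt_enormSq]
  calc _ ≤ √(B * enormSq d s (fun k => ‖v k - w k‖ₑ)).toReal :=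
        Real.sqrt_le_sqrt (ENNReal.toReal_mono (ENNReal.mul_ne_top hBtop hdiff) hle)
    _ = √B.toReal * √(enormSq d s (fun k => ‖v k - w k‖ₑ)).toReal := by
        rw [ENNReal.toReal_mul, Real.sqrt_mul ENNReal.toReal_nonneg]
    _ ≤ _ := by
        gcongr
        linarith
end

section
/- There exists a constant C > 0 such that for every sequence v = (v_k)_{k∈ℤ²} of complex numbers satisfying Σ_{k∈ℤ²} (1 + |k|²) |v_k|² ≤ 1 and N := ( Σ_{k∈ℤ²} (|k|⁴ + 1) |v_k|² )^{1/2} < ∞, one has Σ_{k∈ℤ²} |v_k| ≤ C (1 + √(log(1 + N))). (This is the Fourier-coefficient form of the Brezis–Gallouët inequality: for u ∈ H²(𝕋²) with ‖u‖_{H¹} ≤ 1 one has ‖u‖_{L^∞} ≤ C(1 + √(log(1 + ‖u‖_{H²}))), since ‖u‖_{L^∞} is bounded by the sum of the absolute values of the Fourier coefficients.) -/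
open scoped BigOperators

/-- The sup norm of a lattice point of `ℤ²`. -/
def supNat (k : Fin 2 → ℤ) : ℕ := max (k 0).natAbs (k 1).natAbs

lemma card_filter_supNat_le (s : Finset (Fin 2 → ℤ)) (n : ℕ) :
    (s.filter fun k => supNat k = n).card ≤ 8 * n + 1 := by
  have hbox : (Finset.box n : Finset (ℤ × ℤ)).card ≤ 8 * n + 1 := by
    rcases Nat.eq_zero_or_pos n with rfl | hn
    · simp
    · rw [Int.card_box hn.ne']
      omega
  refine le_trans (Finset.card_le_card_of_injOn (fun k => (k 0, k 1)) ?_ ?_) hbox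
  · intro k hk
    exact Int.mem_box.2 (Finset.mem_filter.1 hk).2
  · intro k _ l _ hkl
    simp only [Prod.mk.injEq] at hkl
    ext i
    fin_cases i
    · exact hkl.1
    · exact hkl.2

lemma supNat_sq_le_lam (k : Fin 2 → ℤ) : ((supNat k : ℕ) : ℝ) ^ 2 ≤ lam 2 k := by
  have h : ((supNat k : ℕ) : ℤ) ^ 2 ≤ lam 2 k := by
    simp only [lam, Fin.sum_univ_two, supNat]
    rcases max_choice (k 0).natAbs (k 1).natAbs with h | h <;> rw [h, Int.natAbs_sq] <;>
      nlinarith [sq_nonneg (k 0), sq_nonneg (k 1)]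
  exact_mod_cast h

lemma div_le_log_sub_log {a m : ℝ} (ha : 0 < a) (hm : 1 ≤ m) :
    a / (m * (a + m ^ 2)) ≤
      4 / 3 * (Real.log (1 + a / m ^ 2) - Real.log (1 + a / (m + 1) ^ 2)) := by
  have hm0 : 0 < m := by linarith
  have hx : 0 < 1 + a / m ^ 2 := by positivity
  have hy : 0 < 1 + a / (m + 1) ^ 2 := by positivity
  have hlog := Real.one_sub_inv_le_log_of_pos (div_pos hx hy)
  rw [Real.log_div hx.ne' hy.ne'] at hlog
  refine le_trans ?_ (mul_le_mul_of_nonneg_left hlog (by norm_num))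
  have heq : 1 - ((1 + a / m ^ 2) / (1 + a / (m + 1) ^ 2))⁻¹ =
      a * (2 * m + 1) / ((m + 1) ^ 2 * (a + m ^ 2)) := by
    have : m ^ 2 + a ≠ 0 := by positivity
    field_simp
    ring
  rw [heq, ← mul_div_assoc, div_le_div_iff₀ (by positivity) (by positivity)]
  have hpoly : 0 ≤ 4 / 3 * (2 * m + 1) * m - (m + 1) ^ 2 := by nlinarith
  have := mul_nonneg (mul_nonneg ha.le (by positivity : (0 : ℝ) ≤ a + m ^ 2)) hpoly
  nlinarith

lemma sum_range_div_le_log {a : ℝ} (ha : 0 < a) (R : ℕ) :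
    ∑ n ∈ Finset.range R, a / (((n : ℝ) + 1) * (a + ((n : ℝ) + 1) ^ 2)) ≤
      4 / 3 * Real.log (1 + a) := by
  have h : ∀ n ∈ Finset.range R, a / (((n : ℝ) + 1) * (a + ((n : ℝ) + 1) ^ 2)) ≤
      4 / 3 * Real.log (1 + a / ((n : ℝ) + 1) ^ 2) -
        4 / 3 * Real.log (1 + a / (((n + 1 : ℕ) : ℝ) + 1) ^ 2) := by
    intro n _
    have := div_le_log_sub_log ha (m := (n : ℝ) + 1) (by simp)
    push_cast
    linarith
  refine (Finset.sum_le_sum h).trans ?_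
  rw [Finset.sum_range_sub' (fun n : ℕ => 4 / 3 * Real.log (1 + a / ((n : ℝ) + 1) ^ 2))]
  have : 0 ≤ Real.log (1 + a / ((R : ℝ) + 1) ^ 2) :=
    Real.log_nonneg (by linarith [show 0 ≤ a / ((R : ℝ) + 1) ^ 2 by positivity])
  simp only [Nat.cast_zero, zero_add, one_pow, div_one]
  linarith

lemma mul_inv_weight_le {a : ℝ} (ha : 0 < a) (n : ℕ) :
    (8 * (n : ℝ) + 1) * (1 + (n : ℝ) ^ 2 + (((n : ℝ) ^ 2) ^ 2 + 1) / a)⁻¹ ≤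
      64 * (a / (((n : ℝ) + 1) * (a + ((n : ℝ) + 1) ^ 2))) := by
  have hn : (0 : ℝ) ≤ n := n.cast_nonneg
  have hsq : ((n : ℝ) + 1) ^ 2 ≤ 2 * (1 + (n : ℝ) ^ 2) := by nlinarith [sq_nonneg ((n : ℝ) - 1)]
  have hfour : (((n : ℝ) + 1) ^ 2) ^ 2 ≤ 8 * (((n : ℝ) ^ 2) ^ 2 + 1) := by
    have := pow_le_pow_left₀ (by positivity) hsq 2
    nlinarith [sq_nonneg ((n : ℝ) ^ 2 - 1)]
  have hw : ((n : ℝ) + 1) ^ 2 * (a + ((n : ℝ) + 1) ^ 2) / (8 * a) ≤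
      1 + (n : ℝ) ^ 2 + (((n : ℝ) ^ 2) ^ 2 + 1) / a := by
    rw [div_le_iff₀ (by positivity), add_mul, div_mul_eq_mul_div, mul_div_assoc, mul_div_cancel_right₀ _ ha.ne']
    nlinarith [mul_le_mul_of_nonneg_right hsq ha.le, mul_nonneg (sq_nonneg (n : ℝ)) ha.le]
  calc _ ≤ (8 * ((n : ℝ) + 1)) *
        (((n : ℝ) + 1) ^ 2 * (a + ((n : ℝ) + 1) ^ 2) / (8 * a))⁻¹ := by
        gcongr
        linarith
    _ = _ := by
        field_simp
        norm_num

lemma sum_inv_weight_le {a : ℝ} (ha : 0 < a) (s : Finset (Fin 2 → ℤ)) :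
    ∑ k ∈ s, (1 + (lam 2 k : ℝ) + ((lam 2 k : ℝ) ^ 2 + 1) / a)⁻¹ ≤
      256 / 3 * Real.log (1 + a) := by
  set g : ℕ → ℝ := fun n => (1 + (n : ℝ) ^ 2 + (((n : ℝ) ^ 2) ^ 2 + 1) / a)⁻¹ with hg
  obtain ⟨R, hR⟩ : ∃ R, ∀ k ∈ s, supNat k ∈ Finset.range R :=
    ⟨s.sup supNat + 1, fun k hk => Finset.mem_range.2 (Nat.lt_succ_of_le (Finset.le_sup hk))⟩
  calc _ ≤ ∑ k ∈ s, g (supNat k) := by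
        refine Finset.sum_le_sum fun k _ => ?_
        have := supNat_sq_le_lam k
        simp only [hg]
        gcongr
    _ = ∑ n ∈ Finset.range R, ∑ k ∈ s with supNat k = n, g (supNat k) :=
        (Finset.sum_fiberwise_of_maps_to hR _).symm
    _ ≤ ∑ n ∈ Finset.range R, 64 * (a / (((n : ℝ) + 1) * (a + ((n : ℝ) + 1) ^ 2))) := by
        refine Finset.sum_le_sum fun n _ => le_trans ?_ (mul_inv_weight_le ha n)
        rw [Finset.sum_congr rfl fun k hk => by rw [(Finset.mem_filter.1 hk).2],
          Finset.sum_const, nsmul_eq_mul]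
        have : ((s.filter fun k => supNat k = n).card : ℝ) ≤ 8 * (n : ℝ) + 1 := by
          exact_mod_cast card_filter_supNat_le s n
        exact mul_le_mul_of_nonneg_right this (by positivity)
    _ ≤ _ := by
        rw [← Finset.mul_sum]
        linarith [sum_range_div_le_log ha R]

/-- Brezis–Gallouët inequality, Fourier form: there is `C > 0` such that
for every `v : ℤ² → ℂ` with `Σ (1+|k|²)|v_k|² ≤ 1` and
`N = (Σ (|k|⁴+1)|v_k|²)^{1/2} < ∞`, one has `Σ |v_k| ≤ C (1 + √(log(1+N)))`. -/
theorem brezis_gallouet :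
    ∃ C : ℝ, 0 < C ∧ ∀ v : (Fin 2 → ℤ) → ℂ,
      Summable (fun k => (1 + (lam 2 k : ℝ)) * ‖v k‖ ^ 2) →
      (∑' k, (1 + (lam 2 k : ℝ)) * ‖v k‖ ^ 2) ≤ 1 →
      Summable (fun k => ((lam 2 k : ℝ) ^ 2 + 1) * ‖v k‖ ^ 2) →
      Summable (fun k => ‖v k‖) ∧
      ∑' k, ‖v k‖ ≤ C * (1 + Real.sqrt (Real.log
        (1 + Real.sqrt (∑' k, ((lam 2 k : ℝ) ^ 2 + 1) * ‖v k‖ ^ 2)))) := by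
  refine ⟨27, by norm_num, fun v h₁ hle h₂ => ?_⟩
  set N := Real.sqrt (∑' k, ((lam 2 k : ℝ) ^ 2 + 1) * ‖v k‖ ^ 2) with hN
  have hlam : ∀ k, (0 : ℝ) ≤ lam 2 k := fun k => (sq_nonneg _).trans (supNat_sq_le_lam k)
  have hN0 : 0 ≤ N := Real.sqrt_nonneg _
  have hNsq : ∑' k, ((lam 2 k : ℝ) ^ 2 + 1) * ‖v k‖ ^ 2 = N ^ 2 :=
    (Real.sq_sqrt (tsum_nonneg fun k => by positivity)).symm
  have hL : 0 ≤ Real.log (1 + N) := Real.log_nonneg (by linarith)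
  have ha : 0 < (1 + N) ^ 2 := by positivity
  have hlog : Real.log (1 + (1 + N) ^ 2) ≤ 2 + 2 * Real.log (1 + N) := by
    calc Real.log (1 + (1 + N) ^ 2) ≤ Real.log ((2 * (1 + N)) ^ 2) :=
          Real.log_le_log (by positivity) (by nlinarith)
      _ = 2 * (Real.log 2 + Real.log (1 + N)) := by
          rw [Real.log_pow, Real.log_mul two_ne_zero (by positivity)]
          norm_num
      _ ≤ _ := by linarith [Real.log_two_lt_d9]
  have key : ∀ s : Finset (Fin 2 → ℤ),
      ∑ k ∈ s, ‖v k‖ ≤ 27 * (1 + Real.sqrt (Real.log (1 + N))) := by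
    intro s
    set w : (Fin 2 → ℤ) → ℝ :=
      fun k => 1 + (lam 2 k : ℝ) + ((lam 2 k : ℝ) ^ 2 + 1) / (1 + N) ^ 2 with hw
    have hw0 : ∀ k, 0 < w k := fun k => by
      have := hlam k
      positivity
    have hcs : (∑ k ∈ s, ‖v k‖) ^ 2 ≤ (∑ k ∈ s, (w k)⁻¹) * ∑ k ∈ s, w k * ‖v k‖ ^ 2 :=
      Finset.sum_sq_le_sum_mul_sum_of_sq_le_mul s (fun k _ => (inv_pos.2 (hw0 k)).le)
        (fun k _ => mul_nonneg (hw0 k).le (sq_nonneg _))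
        (fun k _ => (inv_mul_cancel_left₀ (hw0 k).ne' _).ge)
    have hwv : ∑ k ∈ s, w k * ‖v k‖ ^ 2 ≤ 2 := by
      have hs₁ := (h₁.sum_le_tsum s fun k _ =>
        mul_nonneg (by linarith [hlam k]) (sq_nonneg _)).trans hle
      have hs₂ := h₂.sum_le_tsum s fun k _ => by positivity
      rw [hNsq] at hs₂
      have hsplit : ∑ k ∈ s, w k * ‖v k‖ ^ 2 = ∑ k ∈ s, (1 + (lam 2 k : ℝ)) * ‖v k‖ ^ 2 +
          (∑ k ∈ s, ((lam 2 k : ℝ) ^ 2 + 1) * ‖v k‖ ^ 2) / (1 + N) ^ 2 := by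
        rw [Finset.sum_div, ← Finset.sum_add_distrib]
        exact Finset.sum_congr rfl fun k _ => by simp only [hw]; ring
      have : (∑ k ∈ s, ((lam 2 k : ℝ) ^ 2 + 1) * ‖v k‖ ^ 2) / (1 + N) ^ 2 ≤ 1 :=
        (div_le_one ha).2 (hs₂.trans (by nlinarith))
      linarith
    have hinv : ∑ k ∈ s, (w k)⁻¹ ≤ 256 / 3 * (2 + 2 * Real.log (1 + N)) :=
      (sum_inv_weight_le ha s).trans (by linarith)
    have hsum := hcs.trans
      (mul_le_mul hinv hwv (Finset.sum_nonneg fun k _ => mul_nonneg (hw0 k).le (sq_nonneg _))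
        (by positivity))
    refine abs_le_of_sq_le_sq' (hsum.trans ?_) (by positivity) |>.2
    have hsq := Real.sq_sqrt hL
    nlinarith [Real.sqrt_nonneg (Real.log (1 + N))]
  exact ⟨summable_of_sum_le (fun k => norm_nonneg _) key,
    Real.tsum_le_of_sum_le (fun k => norm_nonneg _) key⟩
end

section
/- Let A > 0, C > 0, q ≥ 1 an integer, ε > 0 and T > 0, and assume ε C (2A)^{2q} ≤ 1/2. Let f : [0, T] → [0, ∞) be continuous with f(0) ≤ A, and suppose that f(t)² ≤ A² + ε C f(t)^{2q+2} for every t ∈ [0, T]. Then f(t) ≤ 2A for every t ∈ [0, T]. -/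
/-- bootstrap lemma: let `A, C > 0`, `q ≥ 1`, `ε > 0`, `T > 0` with
`ε C (2A)^{2q} ≤ 1/2`. If `f : [0,T] → [0,∞)` is continuous, `f(0) ≤ A` and
`f(t)² ≤ A² + ε C f(t)^{2q+2}` on `[0,T]`, then `f(t) ≤ 2A` on `[0,T]`. -/
theorem bootstrap_bound (A C : ℝ) (hA : 0 < A) (hC : 0 < C) (q : ℕ) (hq : 1 ≤ q)
    (ε T : ℝ) (hε : 0 < ε) (hT : 0 < T)
    (hsmall : ε * C * (2 * A) ^ (2 * q) ≤ 1 / 2)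
    (f : ℝ → ℝ) (hcont : ContinuousOn f (Set.Icc 0 T))
    (hnn : ∀ t ∈ Set.Icc (0 : ℝ) T, 0 ≤ f t)
    (hf0 : f 0 ≤ A)
    (hineq : ∀ t ∈ Set.Icc (0 : ℝ) T, f t ^ 2 ≤ A ^ 2 + ε * C * f t ^ (2 * q + 2)) :
    ∀ t ∈ Set.Icc (0 : ℝ) T, f t ≤ 2 * A := by
  intro t ht
  by_contra! hlt
  have hsub : Set.Icc 0 t ⊆ Set.Icc 0 T := Set.Icc_subset_Icc_right ht.2
  obtain ⟨s, hs, hfs⟩ := intermediate_value_Icc ht.1 (hcont.mono hsub)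
    (show 2 * A ∈ Set.Icc (f 0) (f t) from ⟨by linarith, hlt.le⟩)
  have h := hineq s (hsub hs)
  rw [hfs, pow_add, ← mul_assoc] at h
  have hmul := mul_le_mul_of_nonneg_right hsmall (sq_nonneg (2 * A))
  nlinarith [sq_pos_of_pos hA]
end

section
/- Let K ≥ 0, T > 0 and let y : [0, T] → [0, ∞) be differentiable with y′(t) ≤ K · y(t) · (1 + log(1 + y(t))) for every t ∈ [0, T]. Then for every t ∈ [0, T] one has 1 + log(1 + y(t)) ≤ (1 + log(1 + y(0))) · e^{K t}; in particular y(t) ≤ exp( (1 + log(1 + y(0))) e^{K t} ). -/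
/-- Grönwall's inequality for a real function whose derivative is bounded above by a multiple of the function, with no sign
condition on the derivative. -/
lemma le_mul_exp_of_hasDerivWithinAt_le {f f' : ℝ → ℝ} {K a b : ℝ}
    (hf : ∀ t ∈ Set.Icc a b, HasDerivWithinAt f (f' t) (Set.Icc a b) t)
    (bound : ∀ t ∈ Set.Icc a b, f' t ≤ K * f t) :
    ∀ t ∈ Set.Icc a b, f t ≤ f a * Real.exp (K * (t - a)) := by
  intro t ht
  rw [← gronwallBound_ε0]
  refine le_gronwallBound_of_liminf_deriv_right_le (f' := f')
    (fun x hx => (hf x hx).continuousWithinAt) (fun x hx r hr => ?_) le_rfl (fun x hx => ?_) t ht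
  · exact ((hf x (Set.Ico_subset_Icc_self hx)).mono_of_mem_nhdsWithin
      (Icc_mem_nhdsGE_of_mem hx)).liminf_right_slope_le hr
  · simpa using bound x (Set.Ico_subset_Icc_self hx)

/-- logarithmic Grönwall lemma: let `K ≥ 0`, `T > 0` and let
`y : [0,T] → [0,∞)` be differentiable with `y′(t) ≤ K y(t)(1 + log(1+y(t)))` on `[0,T]`.
Then `1 + log(1+y(t)) ≤ (1 + log(1+y(0))) e^{Kt}` and in particular
`y(t) ≤ exp((1 + log(1+y(0))) e^{Kt})` on `[0,T]`. -/
theorem log_gronwall (K T : ℝ) (hK : 0 ≤ K) (hT : 0 < T)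
    (y y' : ℝ → ℝ)
    (hderiv : ∀ t ∈ Set.Icc (0 : ℝ) T, HasDerivWithinAt y (y' t) (Set.Icc 0 T) t)
    (hnn : ∀ t ∈ Set.Icc (0 : ℝ) T, 0 ≤ y t)
    (hineq : ∀ t ∈ Set.Icc (0 : ℝ) T, y' t ≤ K * y t * (1 + Real.log (1 + y t))) :
    ∀ t ∈ Set.Icc (0 : ℝ) T,
      1 + Real.log (1 + y t) ≤ (1 + Real.log (1 + y 0)) * Real.exp (K * t) ∧
      y t ≤ Real.exp ((1 + Real.log (1 + y 0)) * Real.exp (K * t)) := by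
  intro t ht
  have key : 1 + Real.log (1 + y t) ≤ (1 + Real.log (1 + y 0)) * Real.exp (K * t) := by
    have hlog : ∀ s ∈ Set.Icc (0 : ℝ) T, HasDerivWithinAt (fun s => 1 + Real.log (1 + y s))
        (y' s / (1 + y s)) (Set.Icc 0 T) s := fun s hs =>
      (((hderiv s hs).const_add 1).log (by linarith [hnn s hs])).const_add 1
    have hle : ∀ s ∈ Set.Icc (0 : ℝ) T,
        y' s / (1 + y s) ≤ K * (1 + Real.log (1 + y s)) := by
      intro s hs
      have hy := hnn s hs
      have hl : 0 ≤ Real.log (1 + y s) := Real.log_nonneg (by linarith)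
      rw [div_le_iff₀ (by linarith)]
      have : 0 ≤ K * (1 + Real.log (1 + y s)) := by positivity
      linarith [hineq s hs]
    simpa using le_mul_exp_of_hasDerivWithinAt_le hlog hle t ht
  refine ⟨key, ?_⟩
  have hy := hnn t ht
  calc y t ≤ 1 + y t := by linarith
    _ = Real.exp (Real.log (1 + y t)) := (Real.exp_log (by linarith)).symm
    _ ≤ _ := Real.exp_le_exp.mpr (by linarith)
end
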